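/- Let ψ(u) = (1/2)(u + √(1 + u²)) and fix β with 0 < β < 1. Then for every t ≠ 0, |ψ'(t) − ψ'(t/β)| ≤ 1/(4t²); consequently the function t ↦ |ψ'(t) − ψ'(t/β)| is integrable on ℝ and the function t ↦ (ψ'(t) − ψ'(t/β))² is integrable on ℝ. -/

import Mathlib

open MeasureTheory

lemma abs_div_sqrt_one_add_sq_le_one (u : ℝ) : |u / Real.sqrt (1 + u ^ 2)| ≤ 1 := by
  have hs : 0 < Real.sqrt (1 + u ^ 2) := Real.sqrt_pos.2 (by positivity)
  rw [abs_div, abs_of_pos hs, div_le_one hs]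
  exact Real.abs_le_sqrt (by linarith)

lemma one_sub_div_sqrt_one_add_sq_le {u : ℝ} (hu : 0 < u) :
    1 - u / Real.sqrt (1 + u ^ 2) ≤ 1 / (2 * u ^ 2) := by
  have hs : 0 < Real.sqrt (1 + u ^ 2) := Real.sqrt_pos.2 (by positivity)
  have hsq : Real.sqrt (1 + u ^ 2) ^ 2 = 1 + u ^ 2 := Real.sq_sqrt (by positivity)
  have hle : u ≤ Real.sqrt (1 + u ^ 2) := Real.le_sqrt_of_sq_le (by linarith)
  generalize Real.sqrt (1 + u ^ 2) = s at hs hsq hle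
  have key : 1 - u / s = 1 / (s * (s + u)) := by
    field_simp
    linarith
  rw [key]
  exact one_div_le_one_div_of_le (by positivity) (by nlinarith)

lemma abs_sub_div_sqrt_one_add_sq_le_of_pos {t v : ℝ} (ht : 0 < t) (hv : t ≤ v) :
    |t / Real.sqrt (1 + t ^ 2) - v / Real.sqrt (1 + v ^ 2)| ≤ 1 / (2 * t ^ 2) := by
  have ht' := one_sub_div_sqrt_one_add_sq_le ht
  have hv' := one_sub_div_sqrt_one_add_sq_le (ht.trans_le hv)
  have hmono : 1 / (2 * v ^ 2) ≤ 1 / (2 * t ^ 2) := by gcongr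
  have ht1 := (abs_le.1 (abs_div_sqrt_one_add_sq_le_one t)).2
  have hv1 := (abs_le.1 (abs_div_sqrt_one_add_sq_le_one v)).2
  rw [abs_le]
  constructor <;> linarith

lemma abs_sub_div_sqrt_one_add_sq_le {β t : ℝ} (hβ0 : 0 < β) (hβ1 : β ≤ 1) (ht : t ≠ 0) :
    |t / Real.sqrt (1 + t ^ 2) - (t / β) / Real.sqrt (1 + (t / β) ^ 2)| ≤ 1 / (2 * t ^ 2) := by
  rcases ht.lt_or_gt with ht | ht
  · have ht' : 0 < -t := neg_pos.2 ht
    have hneg := abs_sub_div_sqrt_one_add_sq_le_of_pos ht' (le_div_self ht'.le hβ0 hβ1)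
    rwa [neg_div β t, neg_sq, neg_sq, neg_div, neg_div, ← neg_sub', abs_neg] at hneg
  · exact abs_sub_div_sqrt_one_add_sq_le_of_pos ht (le_div_self ht.le hβ0 hβ1)

/-- With ψ'(u) = (1/2)(1 + u/√(1+u²)) and 0 < β < 1, for every t ≠ 0,
|ψ'(t) − ψ'(t/β)| ≤ 1/(4t²); consequently t ↦ |ψ'(t) − ψ'(t/β)| and
t ↦ (ψ'(t) − ψ'(t/β))² are integrable on ℝ. -/
theorem smoothed_hinge_deriv_difference_integrable
    (ψ' : ℝ → ℝ) (h : ∀ u : ℝ, ψ' u = (1/2) * (1 + u / Real.sqrt (1 + u^2)))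
    (β : ℝ) (hβ0 : 0 < β) (hβ1 : β < 1) :
    (∀ t : ℝ, t ≠ 0 → |ψ' t - ψ' (t / β)| ≤ 1 / (4 * t^2)) ∧
    Integrable (fun t : ℝ => |ψ' t - ψ' (t / β)|) ∧
    Integrable (fun t : ℝ => (ψ' t - ψ' (t / β))^2) := by
  have hdiff (t : ℝ) : |ψ' t - ψ' (t / β)| = (1 / 2) *
      |t / Real.sqrt (1 + t ^ 2) - (t / β) / Real.sqrt (1 + (t / β) ^ 2)| := by
    rw [h, h, ← mul_sub, abs_mul, add_sub_add_left_eq_sub, abs_of_pos one_half_pos]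
  have hdecay (t : ℝ) (ht : t ≠ 0) : |ψ' t - ψ' (t / β)| ≤ 1 / (4 * t ^ 2) := by
    calc |ψ' t - ψ' (t / β)| ≤ (1 / 2) * (1 / (2 * t ^ 2)) := by
          rw [hdiff]
          gcongr
          exact abs_sub_div_sqrt_one_add_sq_le hβ0 hβ1.le ht
      _ = 1 / (4 * t ^ 2) := by ring
  have hone (t : ℝ) : |ψ' t - ψ' (t / β)| ≤ 1 := by
    rw [hdiff]
    have := abs_sub (t / Real.sqrt (1 + t ^ 2)) ((t / β) / Real.sqrt (1 + (t / β) ^ 2))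
    linarith [abs_div_sqrt_one_add_sq_le_one t, abs_div_sqrt_one_add_sq_le_one (t / β)]
  have hbound (t : ℝ) : |ψ' t - ψ' (t / β)| ≤ 2 * (1 + t ^ 2)⁻¹ := by
    rw [← div_eq_mul_inv, le_div_iff₀ (by positivity)]
    rcases eq_or_ne t 0 with rfl | ht
    · linarith [hone 0]
    · have := (le_div_iff₀ (by positivity)).1 (hdecay t ht)
      linarith [hone t]
  have hcont : Continuous ψ' := by
    rw [funext h]
    exact continuous_const.mul (continuous_const.add
      (continuous_id.div (by fun_prop) fun u => (Real.sqrt_pos.2 (by positivity)).ne'))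
  have hcontd : Continuous fun t : ℝ => ψ' t - ψ' (t / β) := by fun_prop
  have hint : Integrable fun t : ℝ => |ψ' t - ψ' (t / β)| :=
    (integrable_inv_one_add_sq.const_mul 2).mono' hcontd.abs.aestronglyMeasurable
      (.of_forall fun t => by simpa using hbound t)
  refine ⟨hdecay, hint, hint.mono' (hcontd.pow 2).aestronglyMeasurable (.of_forall fun t => ?_)⟩
  rw [Real.norm_of_nonneg (sq_nonneg _), ← sq_abs]
  exact pow_le_of_le_one (abs_nonneg _) (hone t) two_ne_zero
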